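/- arXiv:1508.07355 — 4 statements merged into one kernel-verified Lean document; each statement's English description precedes it below -/
import Mathlib

section
/- Let G = (V,E) be an (R,c)-expander and let S ⊆ V with |S| = k < c. Then every connected component of the graph G ∖ S (obtained by deleting the vertices of S) has more than R vertices. -/
open scoped Classical

/-- The external neighbourhood of a set of vertices. -/
def extNbhd {V : Type*} (G : SimpleGraph V) (A : Set V) : Set V :=
  {u | u ∉ A ∧ ∃ w ∈ A, G.Adj w u}

/-- `G` is an `(R, c)`-expander: every vertex set of size at most `R` has external
neighbourhood of size at least `c` times its own size. -/
def IsExpander {V : Type*} [Fintype V] (G : SimpleGraph V) (R : ℕ) (c : ℝ) : Prop :=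
  ∀ U : Finset V, U.card ≤ R → c * U.card ≤ ((extNbhd G (↑U : Set V)).ncard : ℝ)

/-- In `G ∖ S`, all external neighbours in `G` of a connected component lie in `S`. -/
theorem extNbhd_image_supp_subset {V : Type*} (G : SimpleGraph V) (S : Set V)
    (K : (G.induce Sᶜ).ConnectedComponent) :
    extNbhd G (Subtype.val '' K.supp) ⊆ S := by
  rintro u ⟨hu, _, ⟨w, hw, rfl⟩, hadj⟩
  by_contra huS
  have hadj' : (G.induce Sᶜ).Adj w ⟨u, huS⟩ := hadj
  exact hu ⟨⟨u, huS⟩, (K.mem_supp_congr_adj hadj').1 hw, rfl⟩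

theorem stmt6 {V : Type*} [Fintype V] (G : SimpleGraph V) (R : ℕ) (c : ℝ)
    (hR : 0 < R) (hc : 0 < c) (hG : IsExpander G R c)
    (S : Finset V) (k : ℕ) (hSk : S.card = k) (hkc : (k : ℝ) < c) :
    ∀ K : (G.induce ((↑S : Set V)ᶜ)).ConnectedComponent, R < K.supp.ncard := by
  intro K
  by_contra! hK
  set U : Finset V := (Subtype.val '' K.supp).toFinset with hU
  have hcoe : (↑U : Set V) = Subtype.val '' K.supp := by simp [hU]
  have hcard : U.card = K.supp.ncard := by
    rw [← Set.ncard_coe_finset, hcoe, Set.ncard_image_of_injective _ Subtype.val_injective]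
  have hpos : 1 ≤ U.card := by
    rw [hcard]
    exact (Set.ncard_pos (Set.toFinite _)).2 K.nonempty_supp
  have hexp := hG U (hcard.trans_le hK)
  have hnbhd : (extNbhd G (↑U : Set V)).ncard ≤ k := by
    rw [hcoe, ← hSk, ← Set.ncard_coe_finset S]
    exact Set.ncard_le_ncard (extNbhd_image_supp_subset G ↑S K) S.finite_toSet
  have hnbhd' : ((extNbhd G (↑U : Set V)).ncard : ℝ) ≤ k := by exact_mod_cast hnbhd
  have hpos' : (1 : ℝ) ≤ U.card := by exact_mod_cast hpos
  nlinarith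
end

section
/- Let C = 150, let C ≤ α = α(n) ≤ n/ln n, let p = p(n) = α·ln n/n, and let G ~ G(n,p). Then with high probability every nonempty set S ⊆ [n] with |S| ≤ 0.8n satisfies |∂S| > |S|·|Sᶜ|·α·ln n/(2n), where ∂S is the set of edges of G with exactly one endpoint in S. -/
open Filter Real

open scoped Classical BigOperators

/-- Probability that `G(n,p)` satisfies the property `P`. -/
noncomputable def gnpProb (n : ℕ) (q : ℝ) (P : SimpleGraph (Fin n) → Prop) : ℝ :=
  ∑ G : SimpleGraph (Fin n),
    if P G then q ^ G.edgeSet.ncard * (1 - q) ^ (n.choose 2 - G.edgeSet.ncard) else 0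

/-- The number of edges of `G` with first endpoint in `A` and second endpoint in `B`.
For disjoint `A` and `B` this is the number of edges of `G` between `A` and `B`;
in particular `edgeCount G S Sᶜ` is the size of the edge boundary `∂S`. -/
noncomputable def edgeCount {V : Type*} (G : SimpleGraph V) (A B : Set V) : ℕ :=
  {q : V × V | q.1 ∈ A ∧ q.2 ∈ B ∧ G.Adj q.1 q.2}.ncard

/-- The unordered pairs with exactly one member in `S`. -/
def Crosses {V : Type*} (S : Set V) (e : Sym2 V) : Prop :=
  ∃ a ∈ S, ∃ b ∈ Sᶜ, e = s(a, b)

lemma edgeCount_compl_eq_card_filter {V : Type*} [Fintype V] (G : SimpleGraph V) (S : Set V) :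
    edgeCount G S Sᶜ = (G.edgeFinset.filter (Crosses S)).card := by
  have himage : (fun q : V × V => s(q.1, q.2)) ''
      {q : V × V | q.1 ∈ S ∧ q.2 ∈ Sᶜ ∧ G.Adj q.1 q.2} =
      ((G.edgeFinset.filter (Crosses S) : Finset (Sym2 V)) : Set (Sym2 V)) := by
    ext e
    simp only [Set.mem_image, Set.mem_ofPred_eq, Finset.coe_filter, SimpleGraph.mem_edgeFinset]
    constructor
    · rintro ⟨⟨a, b⟩, ⟨ha, hb, hab⟩, rfl⟩
      exact ⟨hab, a, ha, b, hb, rfl⟩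
    · rintro ⟨he, a, ha, b, hb, rfl⟩
      exact ⟨(a, b), ⟨ha, hb, he⟩, rfl⟩
  rw [edgeCount, ← Set.ncard_coe_finset, ← himage, Set.InjOn.ncard_image]
  rintro ⟨a, b⟩ ⟨ha, hb, -⟩ ⟨c, d⟩ ⟨hc, hd, -⟩ h
  simp only [Sym2.eq_iff] at h
  rcases h with ⟨rfl, rfl⟩ | ⟨rfl, rfl⟩
  · rfl
  · exact absurd ha hd

lemma edgeCount_top_compl {V : Type*} [Fintype V] [DecidableEq V] (S : Finset V) :
    edgeCount (⊤ : SimpleGraph V) (S : Set V) (S : Set V)ᶜ = S.card * Sᶜ.card := by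
  rw [edgeCount, ← Finset.card_product, ← Set.ncard_coe_finset]
  congr 1
  ext ⟨a, b⟩
  simp only [Set.mem_ofPred_eq, SimpleGraph.top_adj, Finset.coe_product, Set.mem_prod,
    Finset.coe_compl]
  constructor
  · rintro ⟨ha, hb, -⟩
    exact ⟨ha, hb⟩
  · rintro ⟨ha, hb⟩
    exact ⟨ha, hb, fun h => hb (h ▸ ha)⟩

/-- The probability of `G` in the model `G(n,q)`. -/
noncomputable def gnpWeight (n : ℕ) (q : ℝ) (G : SimpleGraph (Fin n)) : ℝ :=
  q ^ G.edgeSet.ncard * (1 - q) ^ (n.choose 2 - G.edgeSet.ncard)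

lemma gnpWeight_nonneg {n : ℕ} {q : ℝ} (h0 : 0 ≤ q) (h1 : q ≤ 1) (G : SimpleGraph (Fin n)) :
    0 ≤ gnpWeight n q G :=
  mul_nonneg (pow_nonneg h0 _) (pow_nonneg (by linarith) _)

lemma sum_gnpWeight_mul_prod (n : ℕ) (q : ℝ) (f : Sym2 (Fin n) → ℝ) :
    ∑ G : SimpleGraph (Fin n), gnpWeight n q G * ∏ e ∈ G.edgeFinset, f e =
      ∏ e ∈ (⊤ : SimpleGraph (Fin n)).edgeFinset, (q * f e + (1 - q)) := by
  rw [Finset.prod_add]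
  refine Finset.sum_bij' (fun G _ => G.edgeFinset)
    (fun A _ => SimpleGraph.fromEdgeSet (A : Set (Sym2 (Fin n)))) ?_ ?_ ?_ ?_ ?_
  · intro G _
    exact Finset.mem_powerset.2 (SimpleGraph.edgeFinset_mono le_top)
  · intro A _
    exact Finset.mem_univ _
  · intro G _
    simp
  · intro A hA
    ext e
    have := fun he : e ∈ A => Finset.mem_powerset.1 hA he
    simp only [SimpleGraph.mem_edgeFinset, SimpleGraph.edgeSet_fromEdgeSet, Set.mem_sdiff,
      Finset.mem_coe, SimpleGraph.edgeSet_top, Sym2.mem_diagSet, Set.mem_compl_iff] at this ⊢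
    tauto
  · intro G _
    have hsub : G.edgeFinset ⊆ (⊤ : SimpleGraph (Fin n)).edgeFinset :=
      SimpleGraph.edgeFinset_mono le_top
    have hcard : G.edgeSet.ncard = G.edgeFinset.card := by
      rw [← Set.ncard_coe_finset, SimpleGraph.coe_edgeFinset]
    rw [Finset.prod_mul_distrib, Finset.prod_const, Finset.prod_const,
      Finset.card_sdiff_of_subset hsub, SimpleGraph.card_edgeFinset_top_eq_card_choose_two,
      Fintype.card_fin, gnpWeight, hcard]
    ring

lemma sum_gnpWeight (n : ℕ) (q : ℝ) : ∑ G : SimpleGraph (Fin n), gnpWeight n q G = 1 := by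
  simpa using sum_gnpWeight_mul_prod n q (fun _ => 1)

/-- The probability generating function of the size of an edge boundary. -/
lemma sum_gnpWeight_mul_pow_edgeCount (n : ℕ) (q z : ℝ) (S : Finset (Fin n)) :
    ∑ G : SimpleGraph (Fin n),
      gnpWeight n q G * z ^ edgeCount G (S : Set (Fin n)) (S : Set (Fin n))ᶜ =
      (q * z + (1 - q)) ^ (S.card * Sᶜ.card) := by
  have h := sum_gnpWeight_mul_prod n q (fun e => if Crosses (S : Set (Fin n)) e then z else 1)
  have hprod : ∀ e : Sym2 (Fin n),
      q * (if Crosses (S : Set (Fin n)) e then z else 1) + (1 - q) =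
        if Crosses (S : Set (Fin n)) e then q * z + (1 - q) else 1 := by
    intro e
    split_ifs <;> ring
  simp only [hprod, ← Finset.prod_filter, Finset.prod_const] at h
  simp only [edgeCount_compl_eq_card_filter]
  rw [h, ← edgeCount_top_compl, edgeCount_compl_eq_card_filter]
  congr!

/-- The first-moment bound with exponential tilting by `1/2`. -/
lemma one_sub_sum_le_gnpProb {n : ℕ} {q : ℝ} (h0 : 0 ≤ q) (h1 : q ≤ 1)
    (F : Finset (Finset (Fin n))) (t : Finset (Fin n) → ℝ) (P : SimpleGraph (Fin n) → Prop)
    (hP : ∀ G, (∀ S ∈ F, t S < (edgeCount G (S : Set (Fin n)) (S : Set (Fin n))ᶜ : ℝ)) → P G) :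
    1 - ∑ S ∈ F, (2 : ℝ) ^ t S * (q * (1 / 2) + (1 - q)) ^ (S.card * Sᶜ.card) ≤
      gnpProb n q P := by
  simp only [← sum_gnpWeight_mul_pow_edgeCount, Finset.mul_sum]
  refine (sub_le_sub_right (sum_gnpWeight n q).ge _).trans ?_
  rw [Finset.sum_comm, ← Finset.sum_sub_distrib, gnpProb]
  refine Finset.sum_le_sum fun G _ => ?_
  have hw := gnpWeight_nonneg h0 h1 G
  have hterm : ∀ S ∈ F, 0 ≤ (2 : ℝ) ^ t S * (gnpWeight n q G *
      (1 / 2) ^ edgeCount G (S : Set (Fin n)) (S : Set (Fin n))ᶜ) := fun S _ => by positivity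
  split_ifs with hG
  · have := Finset.sum_nonneg hterm
    change _ ≤ gnpWeight n q G
    linarith
  · obtain ⟨S, hS, hle⟩ : ∃ S ∈ F,
        (edgeCount G (S : Set (Fin n)) (S : Set (Fin n))ᶜ : ℝ) ≤ t S := by
      by_contra! hcon
      exact hG (hP G hcon)
    have hsingle := Finset.single_le_sum hterm hS
    have hone : 1 ≤ (2 : ℝ) ^ t S *
        (1 / 2) ^ edgeCount G (S : Set (Fin n)) (S : Set (Fin n))ᶜ := by
      rw [one_div, inv_pow, ← Real.rpow_natCast, ← Real.rpow_neg (by norm_num),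
        ← Real.rpow_add (by norm_num)]
      exact Real.one_le_rpow (by norm_num) (by linarith)
    have := mul_le_mul_of_nonneg_left hone hw
    nlinarith

lemma tilted_term_le {q : ℝ} (h1 : q ≤ 1) (N : ℕ) :
    (2 : ℝ) ^ (N * q / 2) * (q * (1 / 2) + (1 - q)) ^ N ≤
      Real.exp (-((1 - Real.log 2) / 2 * (N * q))) := by
  have h : q * (1 / 2) + (1 - q) ≤ Real.exp (-(q / 2)) := by
    have := Real.add_one_le_exp (-(q / 2))
    linarith
  calc (2 : ℝ) ^ (N * q / 2) * (q * (1 / 2) + (1 - q)) ^ N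
      ≤ (2 : ℝ) ^ (N * q / 2) * Real.exp (-(q / 2)) ^ N := by
        gcongr
        linarith
    _ = _ := by
        rw [Real.rpow_def_of_pos (by norm_num), ← Real.exp_nat_mul, ← Real.exp_add]
        congr 1
        ring

lemma sum_nonempty_pow_card_le (n : ℕ) {x : ℝ} (hx : 0 ≤ x) (F : Finset (Finset (Fin n)))
    (hF : ∀ S ∈ F, S.Nonempty) : ∑ S ∈ F, x ^ S.card ≤ Real.exp (n * x) - 1 := by
  have hsum : ∑ S : Finset (Fin n), x ^ S.card = (x + 1) ^ n := by
    simpa using Fintype.sum_pow_mul_eq_add_pow (Fin n) x 1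
  have hsub : insert ∅ F ⊆ (Finset.univ : Finset (Finset (Fin n))) := Finset.subset_univ _
  have hle := Finset.sum_le_sum_of_subset_of_nonneg (f := fun S : Finset (Fin n) => x ^ S.card)
    hsub (fun _ _ _ => pow_nonneg hx _)
  rw [Finset.sum_insert (fun h => Finset.not_nonempty_empty (hF _ h)), hsum] at hle
  have hexp : (x + 1) ^ n ≤ Real.exp (n * x) := by
    rw [Real.exp_nat_mul]
    exact pow_le_pow_left₀ (by linarith) (Real.add_one_le_exp x) n
  simp only [Finset.card_empty, pow_zero] at hle
  linarith

lemma gnpProb_le_one {n : ℕ} {q : ℝ} (h0 : 0 ≤ q) (h1 : q ≤ 1)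
    (P : SimpleGraph (Fin n) → Prop) : gnpProb n q P ≤ 1 := by
  rw [← sum_gnpWeight n q, gnpProb]
  refine Finset.sum_le_sum fun G _ => ?_
  split_ifs
  · exact le_rfl
  · exact gnpWeight_nonneg h0 h1 G

theorem stmt9 (α : ℕ → ℝ)
    (hα : ∀ᶠ n : ℕ in atTop, 150 ≤ α n ∧ α n ≤ (n : ℝ) / Real.log n) :
    Tendsto (fun n : ℕ =>
      gnpProb n (α n * Real.log n / n) (fun G =>
        ∀ S : Finset (Fin n), S.Nonempty → (S.card : ℝ) ≤ 0.8 * n →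
          (S.card : ℝ) * Sᶜ.card * α n * Real.log n / (2 * n) <
            (edgeCount G (↑S : Set (Fin n)) ((↑S : Set (Fin n))ᶜ) : ℝ)))
      atTop (nhds 1) := by
  have hlim : Tendsto (fun n : ℕ => 2 - Real.exp (1 / (n : ℝ))) atTop (nhds 1) := by
    have h := (Real.continuous_exp.tendsto 0).comp
      (tendsto_one_div_atTop_nhds_zero_nat (𝕜 := ℝ))
    have h2 := h.const_sub 2
    norm_num at h2
    simpa [Function.comp_def] using h2
  refine tendsto_of_tendsto_of_tendsto_of_le_of_le' hlim tendsto_const_nhds ?_ ?_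
  · filter_upwards [hα, eventually_ge_atTop 2] with n ⟨hαl, hαu⟩ hn
    have hn' : (2 : ℝ) ≤ n := by exact_mod_cast hn
    have hlog : 0 < Real.log n := Real.log_pos (by linarith)
    have hq0 : 0 ≤ α n * Real.log n / n := by positivity
    have hq1 : α n * Real.log n / n ≤ 1 := by
      rw [div_le_one (by linarith)]
      exact (le_div_iff₀ hlog).1 hαu
    set F : Finset (Finset (Fin n)) :=
      Finset.univ.filter fun S => S.Nonempty ∧ (S.card : ℝ) ≤ 0.8 * n with hF
    refine le_trans ?_ (one_sub_sum_le_gnpProb hq0 hq1 F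
      (fun S => ((S.card * Sᶜ.card : ℕ) : ℝ) * (α n * Real.log n / n) / 2) _ ?_)
    · have hbound : ∀ S ∈ F, (2 : ℝ) ^ (((S.card * Sᶜ.card : ℕ) : ℝ) *
          (α n * Real.log n / n) / 2) * (α n * Real.log n / n * (1 / 2) +
          (1 - α n * Real.log n / n)) ^ (S.card * Sᶜ.card) ≤
          (Real.exp (-(2 * Real.log n))) ^ S.card := by
        intro S hS
        obtain ⟨-, -, hS⟩ := Finset.mem_filter.1 hS
        refine (tilted_term_le hq1 _).trans ?_
        rw [← Real.exp_nat_mul, Real.exp_le_exp]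
        have hcompl : (Sᶜ.card : ℝ) = n - S.card := by
          rw [Finset.card_compl, Fintype.card_fin, Nat.cast_sub]
          simpa using S.card_le_univ
        have hc : 0.2 * (n : ℝ) ≤ Sᶜ.card := by
          rw [hcompl]
          linarith
        have hmain : 30 * (S.card * Real.log n) ≤
            ((S.card * Sᶜ.card : ℕ) : ℝ) * (α n * Real.log n / n) := by
          have : 30 * (S.card * Real.log n) =
              (S.card * (0.2 * n)) * (150 * Real.log n / n) := by
            field_simp
            ring
          rw [this]
          push_cast
          gcongr
        have hl2 := Real.log_two_lt_d9
        have hnn : 0 ≤ (S.card : ℝ) * Real.log n := by positivity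
        nlinarith
      have hsum := (Finset.sum_le_sum hbound).trans
        (sum_nonempty_pow_card_le n (Real.exp_pos _).le F
          fun S hS => (Finset.mem_filter.1 hS).2.1)
      have hx : (n : ℝ) * Real.exp (-(2 * Real.log n)) = 1 / n := by
        rw [Real.exp_neg, two_mul, Real.exp_add, Real.exp_log (by linarith)]
        field_simp
      rw [hx] at hsum
      linarith
    · intro G hG S hS hcard
      have h := hG S (Finset.mem_filter.2 ⟨Finset.mem_univ _, hS, hcard⟩)
      refine lt_of_eq_of_lt ?_ h
      push_cast
      field_simp
  · filter_upwards [hα, eventually_ge_atTop 2] with n ⟨hαl, hαu⟩ hn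
    have hn' : (2 : ℝ) ≤ n := by exact_mod_cast hn
    have hlog : 0 < Real.log n := Real.log_pos (by linarith)
    refine gnpProb_le_one (by positivity) ?_ _
    rw [div_le_one (by linarith)]
    exact (le_div_iff₀ hlog).1 hαu
end

section
/- Let C = 150, let C ≤ α = α(n) < ln²n, let p = p(n) = α·ln n/n, and let G ~ G(n,p). Then with high probability, for every vertex v ∈ [n], every integer 0 ≤ r ≤ ln n/(15·ln ln n), and every vertex w at graph distance exactly r from v, we have |E(w, B(v,r))| ≤ 5, where B(v,r) is the set of vertices at distance at most r from v and E(w, B(v,r)) is the set of edges of G joining w to a vertex of B(v,r). -/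
open Filter Real

open scoped Classical BigOperators

/-- The ball of radius `r` around `v` in `G`. -/
def ball {V : Type*} (G : SimpleGraph V) (v : V) (r : ℕ) : Set V :=
  {u | G.Reachable v u ∧ G.dist v u ≤ r}

/-- The pairs (vertex set, edge set) of trees with `m` edges, grown one pendant vertex at a time. -/
def treePairs (V : Type*) [Fintype V] [DecidableEq V] :
    ℕ → Finset (Finset V × Finset (Sym2 V))
  | 0 => Finset.univ.image fun v => ({v}, ∅)
  | m + 1 => (treePairs V m).biUnion fun T =>
      (T.1ᶜ ×ˢ T.1).image fun z => (insert z.1 T.1, insert s(z.1, z.2) T.2)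

/-- Edge sets consisting of a tree with `m` edges together with `k` edges that join
one further vertex to the tree. -/
def cappedTrees (V : Type*) [Fintype V] [DecidableEq V] (k m : ℕ) : Finset (Finset (Sym2 V)) :=
  (treePairs V m).biUnion fun T =>
    (T.1ᶜ ×ˢ T.1.powersetCard k).image fun z => T.2 ∪ z.2.image fun u => s(z.1, u)

section Counting

variable {V : Type*} [Fintype V] [DecidableEq V]

lemma treePairs_spec {m : ℕ} {T : Finset V × Finset (Sym2 V)} (hT : T ∈ treePairs V m) :
    T.1.card = m + 1 ∧ T.2.card = m ∧ (∀ e ∈ T.2, ¬ e.IsDiag) ∧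
      ∀ e ∈ T.2, ∀ x ∈ e, x ∈ T.1 := by
  induction m generalizing T with
  | zero =>
    simp only [treePairs, Finset.mem_image, Finset.mem_univ, true_and] at hT
    obtain ⟨v, rfl⟩ := hT
    simp
  | succ m ih =>
    simp only [treePairs, Finset.mem_biUnion, Finset.mem_image, Finset.mem_product,
      Finset.mem_compl, Prod.exists] at hT
    obtain ⟨A, S, hAS, x, y, ⟨hx, hy⟩, rfl⟩ := hT
    obtain ⟨h1, h2, h3, h4⟩ := ih hAS
    have hxS : s(x, y) ∉ S := fun h => hx (h4 _ h x (Sym2.mem_mk_left x y))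
    have hxy : x ≠ y := fun h => hx (h ▸ hy)
    refine ⟨?_, ?_, ?_, ?_⟩
    · simp [Finset.card_insert_of_notMem hx, h1]
    · simp [Finset.card_insert_of_notMem hxS, h2]
    · intro e he
      rcases Finset.mem_insert.1 he with rfl | he
      · simpa using hxy
      · exact h3 e he
    · intro e he z hz
      rcases Finset.mem_insert.1 he with rfl | he
      · rcases Sym2.mem_iff.1 hz with rfl | rfl
        · exact Finset.mem_insert_self _ _
        · exact Finset.mem_insert_of_mem hy
      · exact Finset.mem_insert_of_mem (h4 e he z hz)

lemma card_treePairs_le (m : ℕ) :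
    (treePairs V m).card ≤ Fintype.card V ^ (m + 1) * (m + 1) ^ m := by
  induction m with
  | zero =>
    simpa [treePairs] using (Finset.card_image_le : (Finset.univ.image _).card ≤ _)
  | succ m ih =>
    have hstep : (treePairs V (m + 1)).card ≤
        (treePairs V m).card * (Fintype.card V * (m + 1)) := by
      refine Finset.card_biUnion_le_card_mul _ _ _ fun T hT => Finset.card_image_le.trans ?_
      rw [Finset.card_product, (treePairs_spec hT).1]
      exact Nat.mul_le_mul_right _ (Finset.card_le_univ _)
    calc _ ≤ _ := hstep
      _ ≤ Fintype.card V ^ (m + 1) * (m + 1) ^ m * (Fintype.card V * (m + 1)) := by gcongr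
      _ = Fintype.card V ^ (m + 1 + 1) * (m + 1) ^ (m + 1) := by ring
      _ ≤ _ := by gcongr; omega

lemma cappedTrees_spec {k m : ℕ} {S : Finset (Sym2 V)} (hS : S ∈ cappedTrees V k m) :
    S.card = m + k ∧ ∀ e ∈ S, ¬ e.IsDiag := by
  simp only [cappedTrees, Finset.mem_biUnion, Finset.mem_image, Finset.mem_product,
    Finset.mem_compl, Finset.mem_powersetCard, Prod.exists] at hS
  obtain ⟨A, S, hAS, w, U, ⟨hw, hUA, hU⟩, rfl⟩ := hS
  obtain ⟨-, h2, h3, h4⟩ := treePairs_spec hAS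
  constructor
  · rw [Finset.card_union_of_disjoint, h2, Finset.card_image_of_injective, hU]
    · intro a b hab
      exact Sym2.congr_right.1 hab
    · rw [Finset.disjoint_right]
      intro e he heS
      obtain ⟨u, -, rfl⟩ := Finset.mem_image.1 he
      exact hw (h4 _ heS w (Sym2.mem_mk_left w u))
  · intro e he
    rcases Finset.mem_union.1 he with he | he
    · exact h3 e he
    · obtain ⟨u, hu, rfl⟩ := Finset.mem_image.1 he
      have hwu : w ≠ u := fun h => hw (h ▸ hUA hu)
      simpa using hwu

lemma card_cappedTrees_le (k m : ℕ) :
    (cappedTrees V k m).card ≤ Fintype.card V ^ (m + 2) * (m + 1) ^ (m + k) := by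
  have hstep : (cappedTrees V k m).card ≤
      (treePairs V m).card * (Fintype.card V * (m + 1) ^ k) := by
    refine Finset.card_biUnion_le_card_mul _ _ _ fun T hT => Finset.card_image_le.trans ?_
    rw [Finset.card_product, Finset.card_powersetCard, (treePairs_spec hT).1]
    exact Nat.mul_le_mul (Finset.card_le_univ _) (Nat.choose_le_pow _ _)
  calc _ ≤ _ := hstep
    _ ≤ Fintype.card V ^ (m + 1) * (m + 1) ^ m * (Fintype.card V * (m + 1) ^ k) :=
        Nat.mul_le_mul_right _ (card_treePairs_le m)
    _ = _ := by ring

end Counting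

section Extraction

variable {V : Type*} [Fintype V] [DecidableEq V] {G : SimpleGraph V}

lemma exists_treePairs_extend {v : V} (d : ℕ) {u : V} (hr : G.Reachable v u)
    (hd : G.dist v u = d) {m : ℕ} {T : Finset V × Finset (Sym2 V)} (hT : T ∈ treePairs V m)
    (hv : v ∈ T.1) (hG : (T.2 : Set (Sym2 V)) ⊆ G.edgeSet) :
    ∃ m' ≤ m + d, ∃ T' ∈ treePairs V m', T.1 ⊆ T'.1 ∧ u ∈ T'.1 ∧
      (T'.2 : Set (Sym2 V)) ⊆ G.edgeSet ∧ ∀ x ∈ T'.1, x ∈ T.1 ∨ G.dist v x < d ∨ x = u := by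
  induction d generalizing u with
  | zero =>
    obtain rfl := hr.dist_eq_zero_iff.1 hd
    exact ⟨m, le_rfl, T, hT, subset_rfl, hv, hG, fun x hx => Or.inl hx⟩
  | succ d ih =>
    obtain ⟨u', hu'r, hu'd, hadj⟩ : ∃ u', G.Reachable v u' ∧ G.dist v u' = d ∧ G.Adj u' u := by
      obtain ⟨p, hp⟩ := hr.symm.exists_walk_length_eq_dist
      rw [G.dist_comm, hd] at hp
      cases p with
      | nil => simp at hp
      | @cons _ b _ h q =>
        have hq : q.length = d := by simpa using hp
        refine ⟨b, q.reachable.symm, ?_, h.symm⟩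
        have h1 : G.dist v b ≤ d := by rw [G.dist_comm, ← hq]; exact SimpleGraph.dist_le q
        obtain ⟨q', hq'⟩ := q.reachable.exists_walk_length_eq_dist
        have h2 := SimpleGraph.dist_le (SimpleGraph.Walk.cons h q')
        rw [G.dist_comm, hd, SimpleGraph.Walk.length_cons, hq', G.dist_comm] at h2
        omega
    obtain ⟨m', hm', T', hT', hsub, hu', hG', hx'⟩ := ih hu'r hu'd
    by_cases hu : u ∈ T'.1
    · refine ⟨m', by omega, T', hT', hsub, hu, hG', fun x hx => ?_⟩
      rcases hx' x hx with h | h | rfl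
      · exact Or.inl h
      · exact Or.inr (Or.inl (by omega))
      · exact Or.inr (Or.inl (by omega))
    · refine ⟨m' + 1, by omega, (insert u T'.1, insert s(u, u') T'.2), ?_,
        hsub.trans (Finset.subset_insert _ _), Finset.mem_insert_self _ _, ?_, fun x hx => ?_⟩
      · simp only [treePairs, Finset.mem_biUnion, Finset.mem_image, Finset.mem_product,
          Finset.mem_compl]
        exact ⟨T', hT', (u, u'), ⟨hu, hu'⟩, rfl⟩
      · rw [Finset.coe_insert, Set.insert_subset_iff]
        exact ⟨hadj.symm, hG'⟩
      · rcases Finset.mem_insert.1 hx with rfl | hx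
        · exact Or.inr (Or.inr rfl)
        rcases hx' x hx with h | h | rfl
        · exact Or.inl h
        · exact Or.inr (Or.inl (by omega))
        · exact Or.inr (Or.inl (by omega))

lemma exists_treePairs_of_subset_ball {v : V} {r : ℕ} (U : Finset V)
    (hU : (U : Set V) ⊆ ball G v r) :
    ∃ m ≤ U.card * r, ∃ T ∈ treePairs V m, v ∈ T.1 ∧ U ⊆ T.1 ∧
      (T.2 : Set (Sym2 V)) ⊆ G.edgeSet ∧ ∀ x ∈ T.1, x = v ∨ x ∈ U ∨ G.dist v x < r := by
  induction U using Finset.induction_on with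
  | empty =>
    exact ⟨0, by simp, ({v}, ∅), by simp [treePairs], by simp, by simp, by simp, by simp⟩
  | insert u U hu ih =>
    rw [Finset.coe_insert, Set.insert_subset_iff] at hU
    obtain ⟨m, hm, T, hT, hv, hUT, hG, hx⟩ := ih hU.2
    obtain ⟨hr, hd⟩ := hU.1
    obtain ⟨m', hm', T', hT', hsub, hu', hG', hx'⟩ :=
      exists_treePairs_extend _ hr rfl hT hv hG
    refine ⟨m', ?_, T', hT', hsub hv, Finset.insert_subset hu' (hUT.trans hsub), hG',
      fun x hxT => ?_⟩
    · rw [Finset.card_insert_of_notMem hu, Nat.add_mul]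
      omega
    · rcases hx' x hxT with h | h | rfl
      · rcases hx x h with h | h | h
        · exact Or.inl h
        · exact Or.inr (Or.inl (Finset.mem_insert_of_mem h))
        · exact Or.inr (Or.inr h)
      · exact Or.inr (Or.inr (h.trans_le hd))
      · exact Or.inr (Or.inl (Finset.mem_insert_self _ _))

lemma exists_cappedTrees_of_lt_edgeCount {v w : V} {k r : ℕ} (hr : G.dist v w = r)
    (hk : k < edgeCount G {w} (ball G v r)) :
    ∃ m ≤ (k + 1) * r, ∃ S ∈ cappedTrees V (k + 1) m, (S : Set (Sym2 V)) ⊆ G.edgeSet := by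
  have himage : {q : V × V | q.1 ∈ ({w} : Set V) ∧ q.2 ∈ ball G v r ∧ G.Adj q.1 q.2} =
      Prod.mk w '' {u | u ∈ ball G v r ∧ G.Adj w u} := by
    ext ⟨a, b⟩
    simp only [Set.mem_singleton_iff, Set.mem_ofPred_eq, Set.mem_image, Prod.mk.injEq]
    constructor
    · rintro ⟨rfl, h⟩
      exact ⟨b, h, rfl, rfl⟩
    · rintro ⟨u, h, rfl, rfl⟩
      exact ⟨rfl, h⟩
  rw [edgeCount, himage, Set.ncard_image_of_injective _ (Prod.mk_right_injective w),
    Set.ncard_eq_toFinset_card'] at hk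
  obtain ⟨U, hUsub, hU⟩ := Finset.exists_subset_card_eq (Nat.succ_le_of_lt hk)
  have hUmem : ∀ u ∈ U, u ∈ ball G v r ∧ G.Adj w u := fun u hu => by simpa using hUsub hu
  obtain ⟨m, hm, T, hT, -, hUT, hG, hx⟩ :=
    exists_treePairs_of_subset_ball U fun u hu => (hUmem u hu).1
  have hw : w ∉ T.1 := by
    intro hwT
    rcases hx w hwT with rfl | h | h
    · obtain ⟨u, hu⟩ : U.Nonempty := Finset.card_pos.1 (by omega)
      obtain ⟨⟨hreach, hle⟩, hadj⟩ := hUmem u hu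
      rw [SimpleGraph.dist_self] at hr
      have : w = u := hreach.dist_eq_zero_iff.1 (by omega)
      exact hadj.ne this
    · exact (hUmem w h).2.ne rfl
    · omega
  refine ⟨m, by rwa [hU] at hm, T.2 ∪ U.image fun u => s(w, u), ?_, ?_⟩
  · simp only [cappedTrees, Finset.mem_biUnion, Finset.mem_image, Finset.mem_product,
      Finset.mem_compl, Finset.mem_powersetCard]
    exact ⟨T, hT, (w, U), ⟨hw, hUT, hU⟩, rfl⟩
  · intro e he
    rcases Finset.mem_union.1 (Finset.mem_coe.1 he) with he | he
    · exact hG he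
    · obtain ⟨u, hu, rfl⟩ := Finset.mem_image.1 he
      exact (hUmem u hu).2

end Extraction

section Probability

lemma gnpProb_superset (n : ℕ) (q : ℝ) (S : Finset (Sym2 (Fin n))) (hS : ∀ e ∈ S, ¬ e.IsDiag) :
    gnpProb n q (fun G => (S : Set (Sym2 (Fin n))) ⊆ G.edgeSet) = q ^ S.card := by
  set E : Finset (Sym2 (Fin n)) := (⊤ : SimpleGraph (Fin n)).edgeFinset with hE
  have hEmem : ∀ e, e ∈ E ↔ ¬ e.IsDiag := by
    intro e
    simp [hE]
  have hEcard : E.card = n.choose 2 := by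
    rw [hE, SimpleGraph.card_edgeFinset_top_eq_card_choose_two, Fintype.card_fin]
  have hSE : S ⊆ E := fun e he => (hEmem e).2 (hS e he)
  have key := Finset.sum_pow_mul_eq_add_pow q (1 - q) (E \ S)
  rw [add_sub_cancel, one_pow] at key
  rw [gnpProb, ← Finset.sum_filter, ← mul_one (q ^ S.card), ← key, Finset.mul_sum]
  refine Finset.sum_bij' (fun G _ => G.edgeFinset \ S)
    (fun t _ => SimpleGraph.fromEdgeSet ((S ∪ t : Finset (Sym2 (Fin n))) : Set (Sym2 (Fin n))))
    ?_ ?_ ?_ ?_ ?_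
  · intro G _
    rw [Finset.mem_powerset]
    refine Finset.sdiff_subset_sdiff (fun e he => (hEmem e).2 ?_) subset_rfl
    exact G.not_isDiag_of_mem_edgeFinset he
  · intro t ht
    rw [Finset.mem_powerset] at ht
    simp only [Finset.mem_filter, Finset.mem_univ, true_and, SimpleGraph.edgeSet_fromEdgeSet]
    intro e he
    exact ⟨by simp [Finset.mem_coe.1 he], hS e he⟩
  · intro G hG
    have hG' : (S : Set (Sym2 (Fin n))) ⊆ G.edgeSet := by simpa using hG
    ext a b
    simp only [SimpleGraph.fromEdgeSet_adj, Finset.mem_coe, Finset.mem_union, Finset.mem_sdiff,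
      SimpleGraph.mem_edgeFinset, SimpleGraph.mem_edgeSet]
    constructor
    · rintro ⟨h | h, -⟩
      · exact hG' h
      · exact h.1
    · intro h
      exact ⟨by tauto, h.ne⟩
  · intro t ht
    rw [Finset.mem_powerset] at ht
    ext e
    simp only [Finset.mem_sdiff, SimpleGraph.mem_edgeFinset, SimpleGraph.edgeSet_fromEdgeSet,
      Set.mem_sdiff, Finset.mem_coe, Finset.mem_union, Sym2.mem_diagSet]
    constructor
    · tauto
    · intro h
      have := Finset.mem_sdiff.1 (ht h)
      exact ⟨⟨Or.inr h, (hEmem e).1 this.1⟩, this.2⟩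
  · intro G hG
    have hG' : S ⊆ G.edgeFinset := by
      intro e he
      have : (S : Set (Sym2 (Fin n))) ⊆ G.edgeSet := by simpa using hG
      exact SimpleGraph.mem_edgeFinset.2 (this he)
    have h1 : G.edgeSet.ncard = G.edgeFinset.card := by
      rw [← SimpleGraph.coe_edgeFinset, Set.ncard_coe_finset]
    have h2 := Finset.card_sdiff_add_card_eq_card hG'
    have h3 := Finset.card_sdiff_add_card_eq_card hSE
    have h4 : G.edgeFinset.card = S.card + (G.edgeFinset \ S).card := by omega
    have h5 : E.card - G.edgeFinset.card = (E \ S).card - (G.edgeFinset \ S).card := by omega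
    rw [h1, ← hEcard, h5, h4, pow_add, mul_assoc, key]

lemma gnpProb_nonneg {n : ℕ} {q : ℝ} (h0 : 0 ≤ q) (h1 : q ≤ 1)
    (P : SimpleGraph (Fin n) → Prop) : 0 ≤ gnpProb n q P := by
  refine Finset.sum_nonneg fun G _ => ?_
  have : 0 ≤ 1 - q := by linarith
  split_ifs <;> positivity

lemma gnpProb_add_gnpProb_not (n : ℕ) (q : ℝ) (P : SimpleGraph (Fin n) → Prop) :
    gnpProb n q P + gnpProb n q (fun G => ¬ P G) = 1 := by
  have h := gnpProb_superset n q ∅ (by simp)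
  simp only [Finset.coe_empty, Set.empty_subset, Finset.card_empty, pow_zero] at h
  rw [← h, gnpProb, gnpProb, gnpProb, ← Finset.sum_add_distrib]
  refine Finset.sum_congr rfl fun G _ => ?_
  by_cases hP : P G <;> simp [hP]

lemma gnpProb_le_sum {n : ℕ} {q : ℝ} (h0 : 0 ≤ q) (h1 : q ≤ 1) {ι : Type*} (I : Finset ι)
    (P : SimpleGraph (Fin n) → Prop) (Q : ι → SimpleGraph (Fin n) → Prop)
    (h : ∀ G, P G → ∃ i ∈ I, Q i G) : gnpProb n q P ≤ ∑ i ∈ I, gnpProb n q (Q i) := by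
  simp only [gnpProb]
  rw [Finset.sum_comm]
  refine Finset.sum_le_sum fun G _ => ?_
  have hq : 0 ≤ 1 - q := by linarith
  have hnn : ∀ i ∈ I, 0 ≤ if Q i G then
      q ^ G.edgeSet.ncard * (1 - q) ^ (n.choose 2 - G.edgeSet.ncard) else 0 := by
    intro i _
    split_ifs <;> positivity
  split_ifs with hP
  · obtain ⟨i, hi, hQ⟩ := h G hP
    refine le_trans ?_ (Finset.single_le_sum hnn hi)
    rw [if_pos hQ]
  · exact Finset.sum_nonneg hnn

/-- First moment bound for the appearance of a tree with at most `M` edges and a further vertex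
with `k` neighbours in it. -/
lemma gnpProb_le_of_cappedTrees {n : ℕ} {q : ℝ} (h0 : 0 ≤ q) (h1 : q ≤ 1) (k M : ℕ)
    (P : SimpleGraph (Fin n) → Prop)
    (h : ∀ G, P G → ∃ m ≤ M, ∃ S ∈ cappedTrees (Fin n) k m,
      (S : Set (Sym2 (Fin n))) ⊆ G.edgeSet) :
    gnpProb n q P ≤
      ∑ m ∈ Finset.range (M + 1), (n : ℝ) ^ (m + 2) * ((m : ℝ) + 1) ^ (m + k) * q ^ (m + k) := by
  refine (gnpProb_le_sum h0 h1
    ((Finset.range (M + 1)).sigma fun m => cappedTrees (Fin n) k m) P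
    (fun i G => (i.2 : Set (Sym2 (Fin n))) ⊆ G.edgeSet) fun G hG => ?_).trans ?_
  · obtain ⟨m, hm, S, hS, hSG⟩ := h G hG
    exact ⟨⟨m, S⟩, Finset.mem_sigma.2 ⟨Finset.mem_range.2 (Nat.lt_succ_of_le hm), hS⟩, hSG⟩
  · rw [Finset.sum_sigma]
    refine Finset.sum_le_sum fun m _ => ?_
    have hcard : ((cappedTrees (Fin n) k m).card : ℝ) ≤
        (n : ℝ) ^ (m + 2) * ((m : ℝ) + 1) ^ (m + k) := by
      have := card_cappedTrees_le (V := Fin n) k m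
      rw [Fintype.card_fin] at this
      exact_mod_cast this
    calc ∑ S ∈ cappedTrees (Fin n) k m,
          gnpProb n q (fun G => (S : Set (Sym2 (Fin n))) ⊆ G.edgeSet)
        = ∑ S ∈ cappedTrees (Fin n) k m, q ^ (m + k) := by
          refine Finset.sum_congr rfl fun S hS => ?_
          obtain ⟨hc, hdiag⟩ := cappedTrees_spec hS
          rw [gnpProb_superset n q S hdiag, hc]
      _ = (cappedTrees (Fin n) k m).card * q ^ (m + k) := by
          rw [Finset.sum_const, nsmul_eq_mul]
      _ ≤ _ := mul_le_mul_of_nonneg_right hcard (pow_nonneg h0 _)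

end Probability

/-- The first moment sum is small once `n * q ≤ L ^ 3` and `L ^ (15 * r) ≤ n`. -/
lemma sum_first_moment_le {n r : ℕ} {q L : ℝ} (hn : 0 < n) (hq : 0 ≤ q) (hL : 1 ≤ L)
    (hnq : n * q ≤ L ^ 3) (hr : L ^ (15 * r) ≤ n) (hrL : 6 * (r : ℝ) + 1 ≤ L) :
    ∑ m ∈ Finset.range (6 * r + 1), (n : ℝ) ^ (m + 2) * ((m : ℝ) + 1) ^ (m + 6) * q ^ (m + 6)
      ≤ L ^ 25 / n := by
  have hn' : (1 : ℝ) ≤ n := by exact_mod_cast hn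
  have hterm : ∀ m ∈ Finset.range (6 * r + 1),
      (n : ℝ) ^ (m + 2) * ((m : ℝ) + 1) ^ (m + 6) * q ^ (m + 6) ≤ L ^ 24 / n := by
    intro m hm
    have hm : m ≤ 6 * r := by simpa [Nat.lt_succ_iff] using hm
    have hm' : (m : ℝ) ≤ 6 * r := by exact_mod_cast hm
    have hmL : (m : ℝ) + 1 ≤ L := by linarith
    rw [le_div_iff₀ (by linarith)]
    have hmain : ((n : ℝ) * q * (m + 1)) ^ (m + 6) ≤ (n : ℝ) ^ 2 * L ^ 24 := by
      calc ((n : ℝ) * q * (m + 1)) ^ (m + 6) ≤ (L ^ 3 * L) ^ (m + 6) := by gcongr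
        _ = L ^ (4 * m) * L ^ 24 := by ring
        _ ≤ L ^ (15 * r * 2) * L ^ 24 := by
          gcongr ?_ * _
          exact pow_le_pow_right₀ hL (by omega)
        _ = (L ^ (15 * r)) ^ 2 * L ^ 24 := by rw [pow_mul]
        _ ≤ _ := by gcongr
    have hsplit : (n : ℝ) ^ (m + 2) * ((m : ℝ) + 1) ^ (m + 6) * q ^ (m + 6) * n * (n : ℝ) ^ 3 =
        ((n : ℝ) * q * (m + 1)) ^ (m + 6) := by
      rw [mul_pow, mul_pow]
      ring
    have hpow : (n : ℝ) ^ 2 ≤ (n : ℝ) ^ 3 := pow_le_pow_right₀ hn' (by norm_num)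
    have hL24 : 0 ≤ L ^ 24 := by positivity
    refine le_of_mul_le_mul_right ?_ (show (0 : ℝ) < (n : ℝ) ^ 3 by positivity)
    rw [hsplit]
    nlinarith [mul_le_mul_of_nonneg_right hpow hL24]
  calc _ ≤ ∑ m ∈ Finset.range (6 * r + 1), L ^ 24 / n := Finset.sum_le_sum hterm
    _ = (6 * (r : ℝ) + 1) * (L ^ 24 / n) := by simp
    _ ≤ L * (L ^ 24 / n) := by gcongr
    _ = _ := by ring

lemma pow_log_le_of_le {x : ℝ} {r : ℕ} (hx : 1 < Real.log x)
    (hr : (r : ℝ) ≤ Real.log x / (15 * Real.log (Real.log x))) (hx0 : 0 < x) :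
    Real.log x ^ (15 * r) ≤ x := by
  have hll : 0 < Real.log (Real.log x) := Real.log_pos hx
  rw [le_div_iff₀ (by positivity)] at hr
  rw [← Real.log_le_log_iff (by positivity) hx0, Real.log_pow]
  push_cast
  linarith

lemma tendsto_log_pow_div_natCast (k : ℕ) :
    Tendsto (fun n : ℕ => Real.log n ^ k / n) atTop (nhds 0) := by
  have h := (isLittleO_pow_log_id_atTop (n := k)).tendsto_div_nhds_zero
  exact h.comp tendsto_natCast_atTop_atTop

theorem stmt11 (α : ℕ → ℝ)
    (hα : ∀ᶠ n : ℕ in atTop, 150 ≤ α n ∧ α n < (Real.log n) ^ 2) :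
    Tendsto (fun n : ℕ =>
      gnpProb n (α n * Real.log n / n) (fun G =>
        ∀ v : Fin n, ∀ r : ℕ, (r : ℝ) ≤ Real.log n / (15 * Real.log (Real.log n)) →
          ∀ w : Fin n, G.Reachable v w → G.dist v w = r →
            edgeCount G {w} (ball G v r) ≤ 5))
      atTop (nhds 1) := by
  have hlog : Tendsto (fun n : ℕ => Real.log n) atTop atTop :=
    Real.tendsto_log_atTop.comp tendsto_natCast_atTop_atTop
  have hbound : Tendsto (fun n : ℕ => 1 - Real.log n ^ 25 / n) atTop (nhds 1) := by
    simpa using (tendsto_log_pow_div_natCast 25).const_sub 1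
  have hev : ∀ᶠ n : ℕ in atTop, 0 < n ∧ 0 ≤ α n * Real.log n / n ∧ α n * Real.log n / n ≤ 1 ∧
      n * (α n * Real.log n / n) ≤ Real.log n ^ 3 ∧ Real.exp 1 ≤ Real.log n := by
    filter_upwards [hα, eventually_gt_atTop 0, hlog.eventually_ge_atTop (Real.exp 1),
      (tendsto_log_pow_div_natCast 3).eventually_le_const zero_lt_one] with n hn h0 hL h3
    have hn0 : (0 : ℝ) < n := by exact_mod_cast h0
    have hL0 : 0 < Real.log n := (Real.exp_pos 1).trans_le hL
    have hle : α n * Real.log n ≤ Real.log n ^ 3 := by nlinarith [hn.2]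
    refine ⟨h0, ?_, ?_, ?_, hL⟩
    · have : 0 ≤ α n := by linarith [hn.1]
      positivity
    · exact (div_le_div_of_nonneg_right hle hn0.le).trans h3
    · rwa [mul_div_cancel₀ _ hn0.ne']
  refine tendsto_of_tendsto_of_tendsto_of_le_of_le' hbound tendsto_const_nhds ?_ ?_
  · filter_upwards [hev, hlog.eventually_ge_atTop 2] with n ⟨h0, hq0, hq1, hnq, hL⟩ hL2
    have hn0 : (0 : ℝ) < n := by exact_mod_cast h0
    have hll : 1 ≤ Real.log (Real.log n) :=
      (Real.le_log_iff_exp_le (by linarith)).2 hL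
    set R := Real.log n / (15 * Real.log (Real.log n)) with hR
    have hR0 : 0 ≤ R := by positivity
    have hRL : R ≤ Real.log n / 15 := by
      rw [hR]
      gcongr
      linarith
    have hfl := Nat.floor_le hR0
    have hsum := sum_first_moment_le (r := ⌊R⌋₊) h0 hq0 (by linarith) hnq
      (pow_log_le_of_le (by linarith) hfl hn0) (by linarith)
    rw [← gnpProb_add_gnpProb_not n (α n * Real.log n / n) (fun G =>
        ∀ v : Fin n, ∀ r : ℕ, (r : ℝ) ≤ R →
          ∀ w : Fin n, G.Reachable v w → G.dist v w = r →
            edgeCount G {w} (ball G v r) ≤ 5), sub_le_iff_le_add]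
    refine add_le_add_right ((gnpProb_le_of_cappedTrees hq0 hq1 6 (6 * ⌊R⌋₊) _
      fun G hG => ?_).trans hsum) _
    push Not at hG
    obtain ⟨v, r, hr, w, -, hd, hlt⟩ := hG
    obtain ⟨m, hm, hS⟩ := exists_cappedTrees_of_lt_edgeCount hd hlt
    exact ⟨m, hm.trans (Nat.mul_le_mul_left 6 (Nat.le_floor hr)), hS⟩
  · filter_upwards [hev] with n ⟨_, hq0, hq1, _⟩
    rw [← gnpProb_add_gnpProb_not n (α n * Real.log n / n) (fun G =>
        ∀ v : Fin n, ∀ r : ℕ, (r : ℝ) ≤ Real.log n / (15 * Real.log (Real.log n)) →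
          ∀ w : Fin n, G.Reachable v w → G.dist v w = r →
            edgeCount G {w} (ball G v r) ≤ 5)]
    exact le_add_of_nonneg_right (gnpProb_nonneg hq0 hq1 _)
end

section
/- Fix an integer k ≥ 1 and let t_+ = n·(ln n + (k−1)·ln ln n + ln ln ln n). For the lazy random walk on the complete graph K_n, with high probability every edge (including loops) of the trace Γ_{t_+} has multiplicity at most 4. -/
open Filter MeasureTheory Real

open scoped Classical BigOperators ENNReal

/-- The multiplicity in the trace `Γ_t` of the walk `ω` of the (possibly degenerate, i.e.
loop) edge `{u, w}`: the number of steps `i < t` traversing it. -/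
def multiplicityIn {n : ℕ} (ω : ℕ → Fin n) (t : ℕ) (u w : Fin n) : ℕ :=
  ((Finset.range t).filter fun i =>
    (ω i = u ∧ ω (i + 1) = w) ∨ (ω i = w ∧ ω (i + 1) = u)).card

/-- If the law on `ℕ → Fin n` has the uniform cylinder probabilities, then prescribing the walk at
the times in a finite set `S` has probability at most `n ^ (-|S|)`. -/
lemma measure_prescribed_le {n : ℕ} (hn : n ≠ 0) (μ : Measure (ℕ → Fin n))
    (hwalk : ∀ m : ℕ, ∀ y : Fin (m + 1) → Fin n,
      μ {ω | ∀ i : Fin (m + 1), ω (i : ℕ) = y i} = ((n : ℝ≥0∞)⁻¹) ^ (m + 1))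
    (S : Finset ℕ) (v : ℕ → Fin n) :
    μ {ω | ∀ i ∈ S, ω i = v i} ≤ ((n : ℝ≥0∞)⁻¹) ^ S.card := by
  obtain ⟨m, hm⟩ : ∃ m, S ⊆ Finset.range (m + 1) :=
    ⟨S.sup id, fun i hi => Finset.mem_range_succ_iff.2 (Finset.le_sup (f := id) hi)⟩
  induction hd : (Finset.range (m + 1) \ S).card generalizing S v with
  | zero =>
    have hS : S = Finset.range (m + 1) :=
      hm.antisymm (Finset.sdiff_eq_empty_iff_subset.1 (Finset.card_eq_zero.1 hd))
    subst hS
    rw [Finset.card_range, ← hwalk m fun i => v i]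
    exact measure_mono fun ω hω i => hω i (Finset.mem_range.2 i.2)
  | succ d ih =>
    obtain ⟨j, hj⟩ : (Finset.range (m + 1) \ S).Nonempty := Finset.card_pos.1 (by omega)
    obtain ⟨hjm, hjS⟩ := Finset.mem_sdiff.1 hj
    have hcover : {ω : ℕ → Fin n | ∀ i ∈ S, ω i = v i} ⊆
        ⋃ x : Fin n, {ω | ∀ i ∈ insert j S, ω i = Function.update v j x i} := by
      intro ω hω
      refine Set.mem_iUnion.2 ⟨ω j, fun i hi => ?_⟩
      by_cases hij : i = j
      · subst hij; simp
      · rw [Function.update_of_ne hij]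
        exact hω i (Finset.mem_of_mem_insert_of_ne hi hij)
    have hbound : ∀ x : Fin n, μ {ω | ∀ i ∈ insert j S, ω i = Function.update v j x i} ≤
        ((n : ℝ≥0∞)⁻¹) ^ (S.card + 1) := by
      intro x
      have h := ih (insert j S) (Function.update v j x) (Finset.insert_subset hjm hm) (by
        rw [Finset.sdiff_insert, Finset.card_erase_of_mem hj, hd, Nat.add_sub_cancel])
      rwa [Finset.card_insert_of_notMem hjS] at h
    calc μ {ω | ∀ i ∈ S, ω i = v i}
        ≤ ∑ x : Fin n, μ {ω | ∀ i ∈ insert j S, ω i = Function.update v j x i} :=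
          (measure_mono hcover).trans (measure_iUnion_fintype_le _ _)
      _ ≤ ∑ _x : Fin n, ((n : ℝ≥0∞)⁻¹) ^ (S.card + 1) := Finset.sum_le_sum fun x _ => hbound x
      _ = ((n : ℝ≥0∞)⁻¹) ^ S.card := by
          rw [Finset.sum_const, Finset.card_univ, Fintype.card_fin, nsmul_eq_mul, pow_succ',
            ← mul_assoc, ENNReal.mul_inv_cancel (by exact_mod_cast hn) (ENNReal.natCast_ne_top n),
            one_mul]

/-- Three disjoint steps of the walk have prescribed endpoints with probability at most
`n ^ (-6)`. -/
lemma measure_three_steps_le {n : ℕ} (hn : n ≠ 0) (μ : Measure (ℕ → Fin n))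
    (hwalk : ∀ m : ℕ, ∀ y : Fin (m + 1) → Fin n,
      μ {ω | ∀ i : Fin (m + 1), ω (i : ℕ) = y i} = ((n : ℝ≥0∞)⁻¹) ^ (m + 1))
    {a b c : ℕ} (hab : a + 2 ≤ b) (hbc : b + 2 ≤ c) (p p' q q' r r' : Fin n) :
    μ {ω | (ω a = p ∧ ω (a + 1) = p') ∧ (ω b = q ∧ ω (b + 1) = q') ∧
      (ω c = r ∧ ω (c + 1) = r')} ≤ ((n : ℝ≥0∞)⁻¹) ^ 6 := by
  have hcard : ({a, a + 1, b, b + 1, c, c + 1} : Finset ℕ).card = 6 := by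
    repeat rw [Finset.card_insert_of_notMem (by simp; try omega)]
    simp
  have h := measure_prescribed_le hn μ hwalk {a, a + 1, b, b + 1, c, c + 1} fun i =>
    if i = a then p else if i = a + 1 then p' else if i = b then q else if i = b + 1 then q'
    else if i = c then r else r'
  rw [hcard] at h
  refine (measure_mono ?_).trans h
  rintro ω ⟨⟨h1, h2⟩, ⟨h3, h4⟩, h5, h6⟩ i hi
  simp only [Finset.mem_insert, Finset.mem_singleton] at hi
  grind

/-- An edge of multiplicity at least `5` is traversed at three pairwise disjoint steps. -/
lemma exists_three_steps_of_multiplicityIn {n : ℕ} {ω : ℕ → Fin n} {t : ℕ} {u w : Fin n}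
    (h : 5 ≤ multiplicityIn ω t u w) :
    ∃ a b c : Fin t, (a : ℕ) + 2 ≤ b ∧ (b : ℕ) + 2 ≤ c ∧ ∀ i ∈ ({a, b, c} : Set (Fin t)),
      (ω i = u ∧ ω (i + 1) = w) ∨ (ω i = w ∧ ω (i + 1) = u) := by
  let f := Finset.orderEmbOfCardLe _ h
  have hf := fun j => Finset.mem_filter.1 (Finset.orderEmbOfCardLe_mem _ h j)
  have hlt : ∀ {i j : Fin 5}, i < j → f i < f j := fun hij => f.strictMono hij
  have h01 : f 0 < f 1 := hlt (by decide)
  have h12 : f 1 < f 2 := hlt (by decide)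
  have h23 : f 2 < f 3 := hlt (by decide)
  have h34 : f 3 < f 4 := hlt (by decide)
  refine ⟨⟨f 0, Finset.mem_range.1 (hf 0).1⟩, ⟨f 2, Finset.mem_range.1 (hf 2).1⟩,
    ⟨f 4, Finset.mem_range.1 (hf 4).1⟩, by simp only; omega, by simp only; omega, ?_⟩
  rintro i (rfl | rfl | rfl)
  exacts [(hf 0).2, (hf 2).2, (hf 4).2]

/-- First moment bound for the existence of an edge of multiplicity at least `5`. -/
lemma measure_not_forall_multiplicityIn_le {n : ℕ} (hn : n ≠ 0) (μ : Measure (ℕ → Fin n))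
    (hwalk : ∀ m : ℕ, ∀ y : Fin (m + 1) → Fin n,
      μ {ω | ∀ i : Fin (m + 1), ω (i : ℕ) = y i} = ((n : ℝ≥0∞)⁻¹) ^ (m + 1)) (t : ℕ) :
    μ {ω | ¬ ∀ u w : Fin n, multiplicityIn ω t u w ≤ 4} ≤
      ((n ^ 2 * t ^ 3 * 8 : ℕ) : ℝ≥0∞) * ((n : ℝ≥0∞)⁻¹) ^ 6 := by
  let E : (Fin n × Fin n) × (Fin t × Fin t × Fin t) × (Bool × Bool × Bool) → Set (ℕ → Fin n) :=
    fun ⟨⟨u, w⟩, ⟨a, b, c⟩, ⟨d, e, f⟩⟩ =>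
      {ω | ((a : ℕ) + 2 ≤ b ∧ (b : ℕ) + 2 ≤ c) ∧
        (ω a = cond d u w ∧ ω (a + 1) = cond d w u) ∧
        (ω b = cond e u w ∧ ω (b + 1) = cond e w u) ∧
        (ω c = cond f u w ∧ ω (c + 1) = cond f w u)}
  have hcover : {ω : ℕ → Fin n | ¬ ∀ u w : Fin n, multiplicityIn ω t u w ≤ 4} ⊆ ⋃ x, E x := by
    intro ω hω
    simp only [Set.mem_ofPred_eq, not_forall, not_le] at hω
    obtain ⟨u, w, h⟩ := hω
    obtain ⟨a, b, c, hab, hbc, hstep⟩ := exists_three_steps_of_multiplicityIn h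
    have horient : ∀ i ∈ ({a, b, c} : Set (Fin t)), ∃ d : Bool,
        ω i = cond d u w ∧ ω (i + 1) = cond d w u := fun i hi =>
      (hstep i hi).elim (fun h => ⟨true, h⟩) (fun h => ⟨false, h⟩)
    obtain ⟨d, hd⟩ := horient a (by simp)
    obtain ⟨e, he⟩ := horient b (by simp)
    obtain ⟨f, hf⟩ := horient c (by simp)
    exact Set.mem_iUnion.2 ⟨⟨⟨u, w⟩, ⟨a, b, c⟩, ⟨d, e, f⟩⟩, ⟨hab, hbc⟩, hd, he, hf⟩
  have hE : ∀ x, μ (E x) ≤ ((n : ℝ≥0∞)⁻¹) ^ 6 := by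
    rintro ⟨⟨u, w⟩, ⟨a, b, c⟩, ⟨d, e, f⟩⟩
    by_cases hgap : (a : ℕ) + 2 ≤ b ∧ (b : ℕ) + 2 ≤ c
    · exact (measure_mono fun ω hω => hω.2).trans
        (measure_three_steps_le hn μ hwalk hgap.1 hgap.2 _ _ _ _ _ _)
    · exact (measure_mono_null (fun ω hω => hgap hω.1) measure_empty).trans_le zero_le
  calc _ ≤ ∑ x, μ (E x) := (measure_mono hcover).trans (measure_iUnion_fintype_le _ _)
    _ ≤ ∑ _x, ((n : ℝ≥0∞)⁻¹) ^ 6 := Finset.sum_le_sum fun x _ => hE x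
    _ = _ := by
      rw [Finset.sum_const, nsmul_eq_mul, Finset.card_univ]
      simp only [Fintype.card_prod, Fintype.card_fin, Fintype.card_bool]
      congr 2
      ring

/-- The time `t₊` is of order at most `n ln n`. -/
lemma eventually_ceil_le_mul_log (k : ℕ) (hk : 1 ≤ k) :
    ∀ᶠ n : ℕ in atTop, ((⌈(n : ℝ) * (Real.log n + ((k : ℝ) - 1) * Real.log (Real.log n) +
      Real.log (Real.log (Real.log n)))⌉₊ : ℕ) : ℝ) ≤ (n : ℝ) * ((k + 2) * Real.log n) := by
  have hlog : Tendsto (fun n : ℕ => Real.log n) atTop atTop :=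
    tendsto_log_atTop.comp tendsto_natCast_atTop_atTop
  filter_upwards [hlog.eventually_ge_atTop 1,
    (tendsto_log_atTop.comp hlog).eventually_ge_atTop 0, eventually_ge_atTop 1] with n h1 h2 hn
  simp only [Function.comp_apply] at h2
  have hn' : (1 : ℝ) ≤ n := by exact_mod_cast hn
  have hk' : (1 : ℝ) ≤ k := by exact_mod_cast hk
  have h3 : Real.log (Real.log n) ≤ Real.log n := Real.log_le_self (by linarith)
  have h4 : Real.log (Real.log (Real.log n)) ≤ Real.log n := (Real.log_le_self h2).trans h3
  have h5 : ((k : ℝ) - 1) * Real.log (Real.log n) ≤ ((k : ℝ) - 1) * Real.log n :=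
    mul_le_mul_of_nonneg_left h3 (by linarith)
  have h6 : (n : ℝ) * (Real.log n + ((k : ℝ) - 1) * Real.log (Real.log n) +
      Real.log (Real.log (Real.log n))) ≤ n * ((k + 1) * Real.log n) :=
    mul_le_mul_of_nonneg_left (by linarith) (by linarith)
  have h7 : (0 : ℝ) ≤ n * ((k + 1) * Real.log n) := by positivity
  have h8 := (Nat.ceil_lt_add_one h7).le
  have h9 : (1 : ℝ) ≤ n * Real.log n := by nlinarith
  calc _ ≤ ((⌈(n : ℝ) * ((k + 1) * Real.log n)⌉₊ : ℕ) : ℝ) := by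
        exact_mod_cast Nat.ceil_mono h6
    _ ≤ _ := by linarith

/-- The first moment bound vanishes for times of order at most `n ln n`. -/
lemma tendsto_first_moment_bound {t : ℕ → ℕ} {C : ℝ}
    (ht : ∀ᶠ n : ℕ in atTop, (t n : ℝ) ≤ n * (C * Real.log n)) :
    Tendsto (fun n : ℕ => ((n ^ 2 * t n ^ 3 * 8 : ℕ) : ℝ≥0∞) * ((n : ℝ≥0∞)⁻¹) ^ 6)
      atTop (nhds 0) := by
  have hlim : Tendsto (fun n : ℕ => 8 * C ^ 3 * (Real.log n ^ 3 / n)) atTop (nhds 0) := by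
    have h := ((isLittleO_pow_log_id_atTop (n := 3)).tendsto_div_nhds_zero.comp
      (tendsto_natCast_atTop_atTop (R := ℝ))).const_mul (8 * C ^ 3)
    simpa using h
  have hlim' := ENNReal.tendsto_ofReal hlim
  rw [ENNReal.ofReal_zero] at hlim'
  refine tendsto_of_tendsto_of_tendsto_of_le_of_le' tendsto_const_nhds hlim'
    (Eventually.of_forall fun _ => zero_le) ?_
  filter_upwards [ht, eventually_ge_atTop 1] with n h hn
  have hn' : (0 : ℝ) < n := by exact_mod_cast hn
  have heq : ((n ^ 2 * t n ^ 3 * 8 : ℕ) : ℝ≥0∞) * ((n : ℝ≥0∞)⁻¹) ^ 6 =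
      ENNReal.ofReal ((n ^ 2 * t n ^ 3 * 8 : ℕ) * ((n : ℝ)⁻¹) ^ 6) := by
    rw [ENNReal.ofReal_mul (by positivity), ENNReal.ofReal_natCast,
      ENNReal.ofReal_pow (by positivity), ENNReal.ofReal_inv_of_pos hn', ENNReal.ofReal_natCast]
  rw [heq]
  refine ENNReal.ofReal_le_ofReal ?_
  have h3 : (t n : ℝ) ^ 3 ≤ (n * (C * Real.log n)) ^ 3 := pow_le_pow_left₀ (by positivity) h 3
  push_cast
  calc (n : ℝ) ^ 2 * t n ^ 3 * 8 * (n : ℝ)⁻¹ ^ 6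
      ≤ (n : ℝ) ^ 2 * (n * (C * Real.log n)) ^ 3 * 8 * (n : ℝ)⁻¹ ^ 6 := by gcongr
    _ = _ := by field_simp

/-- Theorem: for `t₊ = n(ln n + (k-1) ln ln n + ln ln ln n)`, whp every edge (including
loops) of the trace `Γ_{t₊}` of the lazy random walk on `K_n` has multiplicity at most `4`.
The lazy walk on `K_n` stays put with probability `1/n` and otherwise moves to a uniformly
chosen other vertex; equivalently `X_0, X_1, X_2, …` are i.i.d. uniform on `[n]`, so the
law `μ n` of the walk is described by the cylinder probabilities `(1/n)^{m+1}`. -/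
theorem stmt19 (k : ℕ) (hk : 1 ≤ k) (μ : (n : ℕ) → Measure (ℕ → Fin n))
    (hprob : ∀ n, 2 ≤ n → IsProbabilityMeasure (μ n))
    (hwalk : ∀ n, 2 ≤ n → ∀ m : ℕ, ∀ y : Fin (m + 1) → Fin n,
      μ n {ω | ∀ i : Fin (m + 1), ω (i : ℕ) = y i} = ((n : ℝ≥0∞)⁻¹) ^ (m + 1)) :
    Tendsto (fun n : ℕ => μ n {ω | ∀ u w : Fin n,
        multiplicityIn ω
          ⌈(n : ℝ) * (Real.log n + ((k : ℝ) - 1) * Real.log (Real.log n) +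
            Real.log (Real.log (Real.log n)))⌉₊ u w ≤ 4})
      atTop (nhds 1) := by
  set t : ℕ → ℕ := fun n => ⌈(n : ℝ) * (Real.log n + ((k : ℝ) - 1) * Real.log (Real.log n) +
    Real.log (Real.log (Real.log n)))⌉₊ with ht
  have hbad := tendsto_first_moment_bound (t := t) (eventually_ceil_le_mul_log k hk)
  have hlow := ENNReal.Tendsto.sub (tendsto_const_nhds (x := (1 : ℝ≥0∞))) hbad
    (Or.inl ENNReal.one_ne_top)
  rw [tsub_zero] at hlow
  refine tendsto_of_tendsto_of_tendsto_of_le_of_le' hlow tendsto_const_nhds ?_ ?_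
  · filter_upwards [eventually_ge_atTop 2] with n hn
    have := hprob n hn
    rw [tsub_le_iff_right]
    refine le_trans ?_ (add_le_add_right
      (measure_not_forall_multiplicityIn_le (by omega) (μ n) (hwalk n hn) (t n)) _)
    refine le_trans ?_ (measure_union_le _ _)
    rw [← measure_univ (μ := μ n)]
    exact measure_mono fun ω _ => em _
  · filter_upwards [eventually_ge_atTop 2] with n hn
    have := hprob n hn
    exact prob_le_one
end
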